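/- Let X, Y be real Hilbert spaces, A, V : X → Y bounded linear operators with ‖A − V‖ > 0 and ‖V‖ > 0, and γ_G, γ_F > 0 with γ_F γ_G > 2‖A − V‖². Let κ satisfy 0 < κ ≤ min{1/2, 1 − 2‖A − V‖²/(γ_F γ_G), (‖A − V‖²/‖V‖)·√(2/(γ_F γ_G))}, and define τ = √((1 − κ)γ_F/(‖V‖² γ_G)), σ = (γ_G/γ_F)τ, and ω = 1/(1 + τγ_G). Let G : X → ℝ be γ_G-strongly convex and F* : Y → ℝ be γ_F-strongly convex, let (x^i) ⊂ X, (y^i) ⊂ Y satisfy: for every i, (1/τ)(x^i − x^{i+1}) − V*y^i is a subgradient of G at x^{i+1} and (1/σ)(y^i − y^{i+1}) + A(x^{i+1} + ω(x^{i+1} − x^i)) is a subgradient of F* at y^{i+1}, and let (x̂, ŷ) satisfy: −V*ŷ is a subgradient of G at x̂ and A x̂ is a subgradient of F* at ŷ. Then there exists C ≥ 0 such that for all N ∈ ℕ: ‖x^N − x̂‖² + ‖y^N − ŷ‖² ≤ C ω^N. -/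

import Mathlib

open scoped RealInnerProductSpace

/-- `g` is a subgradient of `f : E → ℝ` at `x`. -/
def HasSubgradientAt {E : Type*} [NormedAddCommGroup E] [InnerProductSpace ℝ E]
    (f : E → ℝ) (g x : E) : Prop :=
  ∀ u, f x + ⟪g, u - x⟫ ≤ f u

/-- `f` is `γ`-strongly convex: `u ↦ f u - γ/2 * ‖u‖²` is convex. -/
def StronglyConvexWith {E : Type*} [NormedAddCommGroup E] [InnerProductSpace ℝ E]
    (γ : ℝ) (f : E → ℝ) : Prop :=
  ConvexOn ℝ Set.univ (fun u => f u - γ / 2 * ‖u‖ ^ 2)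

theorem scalar_step (ω β U U' W Q Q' R P00 P01 P10 P11 M : ℝ) (h0 : 0 < ω) (h1 : ω < 1)
    (hX : 0 ≤ W - U' / ω - P10)
    (hY : 0 ≤ β * (R - Q' / ω) + (1 + ω) * P11 - ω * P01 + M)
    (hT1 : 0 ≤ β * (2 / (1 + ω)) * (Q - 2 * (2 / (1 + ω)) * R + (2 / (1 + ω)) ^ 2 * Q')
      - 2 * ((2 * ω / (1 + ω)) * (P00 - (2 / (1 + ω)) * P01) - (P10 - (2 / (1 + ω)) * P11))
      + ((1 + ω) / 2) * ((2 * ω / (1 + ω)) ^ 2 * U - 2 * (2 * ω / (1 + ω)) * W + U'))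
    (hT2 : 0 ≤ β * (2 * (3 + ω) * (1 - ω) / (ω * (1 + ω) ^ 3)) * Q' - 2 * (2 / (1 + ω)) ^ 2 * M
      + 4 * (1 - ω) / (ω * (1 + ω) * (3 + ω)) *
        ((1 + ω) ^ 2 * U' - 2 * ω * (1 + ω) * W + ω ^ 2 * U))
    (hS : 0 ≤ (1 - ω) ^ 2 * U' + 4 * ω * (1 - ω) * W + 4 * ω ^ 2 * U)
    (hU : 0 ≤ U) :
    (1 + ω) / 2 * U' + 2 / (1 + ω) * β * Q' - 2 * (2 * ω / (1 + ω)) * P11 ≤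
    ω * ((1 + ω) / 2 * U + 2 / (1 + ω) * β * Q - 2 * (2 * ω / (1 + ω)) * P00) := by
  have e : ω * ((1 + ω) / 2 * U + 2 / (1 + ω) * β * Q - 2 * (2 * ω / (1 + ω)) * P00)
      - ((1 + ω) / 2 * U' + 2 / (1 + ω) * β * Q' - 2 * (2 * ω / (1 + ω)) * P11)
      = 2 * ω * (W - U' / ω - P10)
      + 2 * ω * (2 / (1 + ω)) ^ 2 * (β * (R - Q' / ω) + (1 + ω) * P11 - ω * P01 + M)
      + ω * (β * (2 / (1 + ω)) * (Q - 2 * (2 / (1 + ω)) * R + (2 / (1 + ω)) ^ 2 * Q')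
      - 2 * ((2 * ω / (1 + ω)) * (P00 - (2 / (1 + ω)) * P01) - (P10 - (2 / (1 + ω)) * P11))
      + ((1 + ω) / 2) * ((2 * ω / (1 + ω)) ^ 2 * U - 2 * (2 * ω / (1 + ω)) * W + U'))
      + ω * (β * (2 * (3 + ω) * (1 - ω) / (ω * (1 + ω) ^ 3)) * Q' - 2 * (2 / (1 + ω)) ^ 2 * M
      + 4 * (1 - ω) / (ω * (1 + ω) * (3 + ω)) *
        ((1 + ω) ^ 2 * U' - 2 * ω * (1 + ω) * W + ω ^ 2 * U))
      + (1 - ω) / (2 * (3 + ω)) * ((1 - ω) ^ 2 * U' + 4 * ω * (1 - ω) * W + 4 * ω ^ 2 * U)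
      + ω * (1 - ω) ^ 2 / (2 * (1 + ω)) * U := by
    have : (3 + ω) ≠ 0 := by positivity
    have : (1 + ω) ≠ 0 := by positivity
    field_simp
    ring
  have h2 : 0 < 1 - ω := by linarith
  have a1 := mul_nonneg (by positivity : 0 ≤ 2 * ω) hX
  have a2 := mul_nonneg (by positivity : 0 ≤ 2 * ω * (2 / (1 + ω)) ^ 2) hY
  have a3 := mul_nonneg h0.le hT1
  have a4 := mul_nonneg h0.le hT2
  have a5 := mul_nonneg (by positivity : 0 ≤ (1 - ω) / (2 * (3 + ω))) hS
  have a6 := mul_nonneg (by positivity : 0 ≤ ω * (1 - ω) ^ 2 / (2 * (1 + ω))) hU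
  linarith

/-- Weighted Young inequality. -/
theorem young {Y : Type*} [NormedAddCommGroup Y] [InnerProductSpace ℝ Y]
    (k B : ℝ) (hk : 0 < k) (p h : Y) (hp : ‖p‖ ^ 2 ≤ k * B) :
    0 ≤ k * ‖h‖ ^ 2 - 2 * ⟪p, h⟫ + B := by
  have h1 : 0 ≤ ‖k • h - p‖ ^ 2 := by positivity
  rw [norm_sub_sq_real, norm_smul, real_inner_smul_left, real_inner_comm, mul_pow,
    Real.norm_eq_abs, sq_abs] at h1
  have h2 : 0 ≤ k * (k * ‖h‖ ^ 2 - 2 * ⟪p, h⟫ + B) := by nlinarith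
  exact nonneg_of_mul_nonneg_right h2 hk

theorem vec_step {X Y : Type*}
    [NormedAddCommGroup X] [InnerProductSpace ℝ X]
    [NormedAddCommGroup Y] [InnerProductSpace ℝ Y]
    (V D : X →L[ℝ] Y) (ω β : ℝ) (h0 : 0 < ω) (h1 : ω < 1) (hβ : 0 < β)
    (hV : ∀ z, ‖V z‖ ^ 2 ≤ β * ‖z‖ ^ 2)
    (hD : ∀ z, ‖D z‖ ^ 2 ≤ β * (((1 - ω) / ω) ^ 2 / 2) * ‖z‖ ^ 2)
    (u u' : X) (v v' : Y)
    (hX : 0 ≤ ⟪u, u'⟫ - ‖u'‖ ^ 2 / ω - ⟪V u', v⟫)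
    (hY : 0 ≤ β * (⟪v, v'⟫ - ‖v'‖ ^ 2 / ω) + (1 + ω) * ⟪V u', v'⟫ - ω * ⟪V u, v'⟫
      + ⟪D ((1 + ω) • u' - ω • u), v'⟫) :
    (1 + ω) / 2 * ‖u'‖ ^ 2 + 2 / (1 + ω) * β * ‖v'‖ ^ 2 - 2 * (2 * ω / (1 + ω)) * ⟪V u', v'⟫ ≤
    ω * ((1 + ω) / 2 * ‖u‖ ^ 2 + 2 / (1 + ω) * β * ‖v‖ ^ 2
      - 2 * (2 * ω / (1 + ω)) * ⟪V u, v⟫) := by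
  have h2 : 0 < 1 - ω := by linarith
  have nsqY : ∀ (s t : ℝ) (a b : Y),
      ‖s • a - t • b‖ ^ 2 = s ^ 2 * ‖a‖ ^ 2 - 2 * s * t * ⟪a, b⟫ + t ^ 2 * ‖b‖ ^ 2 := by
    intro s t a b
    rw [norm_sub_sq_real, norm_smul, norm_smul, real_inner_smul_left, real_inner_smul_right,
      mul_pow, mul_pow, Real.norm_eq_abs, Real.norm_eq_abs, sq_abs, sq_abs]
    ring
  have nsqX : ∀ (s t : ℝ) (a b : X),
      ‖s • a - t • b‖ ^ 2 = s ^ 2 * ‖a‖ ^ 2 - 2 * s * t * ⟪a, b⟫ + t ^ 2 * ‖b‖ ^ 2 := by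
    intro s t a b
    rw [norm_sub_sq_real, norm_smul, norm_smul, real_inner_smul_left, real_inner_smul_right,
      mul_pow, mul_pow, Real.norm_eq_abs, Real.norm_eq_abs, sq_abs, sq_abs]
    ring
  have cu : ⟪u', u⟫ = ⟪u, u'⟫ := real_inner_comm _ _
  refine scalar_step ω β (‖u‖ ^ 2) (‖u'‖ ^ 2) ⟪u, u'⟫ (‖v‖ ^ 2) (‖v'‖ ^ 2) ⟪v, v'⟫
    ⟪V u, v⟫ ⟪V u, v'⟫ ⟪V u', v⟫ ⟪V u', v'⟫ ⟪D ((1 + ω) • u' - ω • u), v'⟫ h0 h1 hX hY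
    ?_ ?_ ?_ (by positivity)
  · have t := young (β * (2 / (1 + ω)))
      (((1 + ω) / 2) * ‖(2 * ω / (1 + ω)) • u - (1 : ℝ) • u'‖ ^ 2) (by positivity)
      (V ((2 * ω / (1 + ω)) • u - (1 : ℝ) • u')) ((1 : ℝ) • v - (2 / (1 + ω)) • v') (by
        refine (hV _).trans (le_of_eq ?_)
        field_simp)
    rw [nsqX, nsqY] at t
    simp only [map_sub, map_smul, inner_sub_left, inner_sub_right, real_inner_smul_left,
      real_inner_smul_right] at t
    refine t.trans (le_of_eq ?_)
    ring
  · have t := young (β * (2 * (3 + ω) * (1 - ω) / (ω * (1 + ω) ^ 3)))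
      ((2 / (1 + ω)) ^ 4 * (β * (((1 - ω) / ω) ^ 2 / 2)
        * ‖(1 + ω) • u' - ω • u‖ ^ 2) / (β * (2 * (3 + ω) * (1 - ω) / (ω * (1 + ω) ^ 3))))
      (by positivity)
      (((2 / (1 + ω)) ^ 2) • D ((1 + ω) • u' - ω • u)) v' (by
        rw [norm_smul, mul_pow, Real.norm_eq_abs, sq_abs, mul_div_cancel₀ _ (by positivity),
          ← pow_mul]
        exact mul_le_mul_of_nonneg_left (hD _) (by positivity))
    rw [nsqX, real_inner_smul_left, cu] at t
    refine t.trans (le_of_eq ?_)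
    have : (1 - ω) ≠ 0 := h2.ne'
    field_simp
    ring
  · have t : 0 ≤ ‖(1 - ω) • u' - (-(2 * ω)) • u‖ ^ 2 := by positivity
    rw [nsqX, cu] at t
    linarith

theorem strong_subgrad {E : Type*} [NormedAddCommGroup E] [InnerProductSpace ℝ E]
    {γ : ℝ} {f : E → ℝ} (hf : StronglyConvexWith γ f) {g x : E}
    (hg : HasSubgradientAt f g x) (u : E) :
    f x + ⟪g, u - x⟫ + γ / 2 * ‖u - x‖ ^ 2 ≤ f u := by
  have key : ∀ t : ℝ, 0 < t → t < 1 →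
      f x + ⟪g, u - x⟫ + γ / 2 * ((1 - t) * ‖u - x‖ ^ 2) ≤ f u := by
    intro t h0 h1
    have c := hf.2 (Set.mem_univ x) (Set.mem_univ u) (by linarith : 0 ≤ 1 - t) h0.le (by ring)
    have s := hg ((1 - t) • x + t • u)
    have e1 : (1 - t) • x + t • u - x = t • (u - x) := by module
    have e2 : ‖(1 - t) • x + t • u‖ ^ 2
        = (1 - t) * ‖x‖ ^ 2 + t * ‖u‖ ^ 2 - t * (1 - t) * ‖u - x‖ ^ 2 := by
      rw [norm_add_sq_real, norm_sub_sq_real, norm_smul, norm_smul, real_inner_smul_left,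
        real_inner_smul_right, mul_pow, mul_pow, Real.norm_eq_abs, Real.norm_eq_abs, sq_abs,
        sq_abs, real_inner_comm x u]
      ring
    rw [e1, real_inner_smul_right] at s
    simp only [smul_eq_mul] at c
    rw [e2] at c
    have : 0 ≤ t * (f u - (f x + ⟪g, u - x⟫ + γ / 2 * ((1 - t) * ‖u - x‖ ^ 2))) := by
      nlinarith
    have := nonneg_of_mul_nonneg_right this h0
    linarith
  have lim : Filter.Tendsto
      (fun t : ℝ => f x + ⟪g, u - x⟫ + γ / 2 * ((1 - t) * ‖u - x‖ ^ 2))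
      (nhdsWithin 0 (Set.Ioi 0)) (nhds (f x + ⟪g, u - x⟫ + γ / 2 * ((1 - 0) * ‖u - x‖ ^ 2))) := by
    apply Filter.Tendsto.mono_left _ nhdsWithin_le_nhds
    apply Continuous.tendsto
    fun_prop
  have := le_of_tendsto lim (by
    filter_upwards [Ioo_mem_nhdsGT (zero_lt_one : (0 : ℝ) < 1)] with t ht
    exact key t ht.1 ht.2)
  simpa using this

theorem strong_mono {E : Type*} [NormedAddCommGroup E] [InnerProductSpace ℝ E]
    {γ : ℝ} {f : E → ℝ} (hf : StronglyConvexWith γ f) {g x g' x' : E}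
    (hg : HasSubgradientAt f g x) (hg' : HasSubgradientAt f g' x') :
    γ * ‖x - x'‖ ^ 2 ≤ ⟪g - g', x - x'⟫ := by
  have h1 := strong_subgrad hf hg x'
  have h2 := strong_subgrad hf hg' x
  have e : ⟪g, x' - x⟫ = - ⟪g, x - x'⟫ := by rw [← inner_neg_right, neg_sub]
  rw [norm_sub_rev, e] at h1
  rw [inner_sub_left]
  linarith

theorem statement10 {X Y : Type*}
    [NormedAddCommGroup X] [InnerProductSpace ℝ X] [CompleteSpace X]
    [NormedAddCommGroup Y] [InnerProductSpace ℝ Y] [CompleteSpace Y]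
    (A V : X →L[ℝ] Y) (hAV : 0 < ‖A - V‖) (hV : 0 < ‖V‖)
    (γG γF : ℝ) (hγG : 0 < γG) (hγF : 0 < γF)
    (hstrict : γF * γG > 2 * ‖A - V‖ ^ 2)
    (κ : ℝ) (hκpos : 0 < κ)
    (hκ : κ ≤ min (1 / 2) (min
      (1 - 2 * ‖A - V‖ ^ 2 / (γF * γG))
      (‖A - V‖ ^ 2 / ‖V‖ * Real.sqrt (2 / (γF * γG)))))
    (τ σ ω : ℝ)
    (hτ : τ = Real.sqrt ((1 - κ) * γF / (‖V‖ ^ 2 * γG)))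
    (hσ : σ = γG / γF * τ)
    (hω : ω = 1 / (1 + τ * γG))
    (G : X → ℝ) (Fstar : Y → ℝ)
    (hG : StronglyConvexWith γG G)
    (hFstar : StronglyConvexWith γF Fstar)
    (x : ℕ → X) (y : ℕ → Y)
    (hx : ∀ i, HasSubgradientAt G
      ((1 / τ) • (x i - x (i + 1)) - ContinuousLinearMap.adjoint V (y i)) (x (i + 1)))
    (hy : ∀ i, HasSubgradientAt Fstar
      ((1 / σ) • (y i - y (i + 1)) + A (x (i + 1) + ω • (x (i + 1) - x i))) (y (i + 1)))
    (xh : X) (yh : Y)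
    (hxh : HasSubgradientAt G (-(ContinuousLinearMap.adjoint V yh)) xh)
    (hyh : HasSubgradientAt Fstar (A xh) yh) :
    ∃ C : ℝ, 0 ≤ C ∧ ∀ N : ℕ, ‖x N - xh‖ ^ 2 + ‖y N - yh‖ ^ 2 ≤ C * ω ^ N := by
  have hκ1 : κ ≤ 1 / 2 := hκ.trans (min_le_left _ _)
  have hκ2 : κ ≤ 1 - 2 * ‖A - V‖ ^ 2 / (γF * γG) :=
    hκ.trans ((min_le_right _ _).trans (min_le_left _ _))
  have hP : 0 < γF * γG := by positivity
  have hDn : 2 * ‖A - V‖ ^ 2 ≤ γF * γG := hstrict.le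
  have hκ' : 0 < 1 - κ := by linarith
  have hτpos : 0 < τ := by rw [hτ]; positivity
  have hτsq : τ ^ 2 = (1 - κ) * γF / (‖V‖ ^ 2 * γG) := by
    rw [hτ]; exact Real.sq_sqrt (by positivity)
  have hω0 : 0 < ω := by rw [hω]; positivity
  have hω1 : ω < 1 := by
    rw [hω, div_lt_one (by positivity)]
    have := mul_pos hτpos hγG
    linarith
  have hθ : (1 - ω) / ω = τ * γG := by
    rw [hω]; field_simp; ring
  have hinv : ∀ r : ℝ, r / ω = (1 + τ * γG) * r := by
    intro r; rw [hω]; field_simp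
  obtain ⟨β, hβ⟩ : ∃ β, β = γF / γG := ⟨_, rfl⟩
  have hβ0 : 0 < β := by rw [hβ]; positivity
  have hVb : ∀ z, ‖(τ • V) z‖ ^ 2 ≤ β * ‖z‖ ^ 2 := by
    intro z
    have h1 : ‖V z‖ ^ 2 ≤ ‖V‖ ^ 2 * ‖z‖ ^ 2 := by
      rw [← mul_pow]; exact pow_le_pow_left₀ (norm_nonneg _) (V.le_opNorm z) 2
    rw [smul_apply, norm_smul, mul_pow, Real.norm_eq_abs, sq_abs]
    have h2 : τ ^ 2 * ‖V‖ ^ 2 = (1 - κ) * β := by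
      rw [hτsq, hβ]; field_simp
    calc τ ^ 2 * ‖V z‖ ^ 2 ≤ τ ^ 2 * (‖V‖ ^ 2 * ‖z‖ ^ 2) := by gcongr
      _ = ((1 - κ) * β) * ‖z‖ ^ 2 := by rw [← h2]; ring
      _ ≤ β * ‖z‖ ^ 2 := by
        gcongr
        nlinarith
  have hDb : ∀ z, ‖(τ • (A - V)) z‖ ^ 2 ≤ β * (((1 - ω) / ω) ^ 2 / 2) * ‖z‖ ^ 2 := by
    intro z
    have h1 : ‖(A - V) z‖ ^ 2 ≤ ‖A - V‖ ^ 2 * ‖z‖ ^ 2 := by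
      rw [← mul_pow]; exact pow_le_pow_left₀ (norm_nonneg _) ((A - V).le_opNorm z) 2
    rw [smul_apply, norm_smul, mul_pow, Real.norm_eq_abs, sq_abs, hθ]
    calc τ ^ 2 * ‖(A - V) z‖ ^ 2 ≤ τ ^ 2 * (‖A - V‖ ^ 2 * ‖z‖ ^ 2) := by gcongr
      _ ≤ τ ^ 2 * (γF * γG / 2 * ‖z‖ ^ 2) := by
        gcongr
        linarith
      _ = β * ((τ * γG) ^ 2 / 2) * ‖z‖ ^ 2 := by
        rw [hβ]; field_simp
  have step : ∀ i, (1 + ω) / 2 * ‖x (i + 1) - xh‖ ^ 2 + 2 / (1 + ω) * β * ‖y (i + 1) - yh‖ ^ 2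
        - 2 * (2 * ω / (1 + ω)) * ⟪(τ • V) (x (i + 1) - xh), y (i + 1) - yh⟫ ≤
      ω * ((1 + ω) / 2 * ‖x i - xh‖ ^ 2 + 2 / (1 + ω) * β * ‖y i - yh‖ ^ 2
        - 2 * (2 * ω / (1 + ω)) * ⟪(τ • V) (x i - xh), y i - yh⟫) := by
    intro i
    refine vec_step (τ • V) (τ • (A - V)) ω β hω0 hω1 hβ0 hVb hDb _ _ _ _ ?_ ?_
    · have h := strong_mono hG (hx i) hxh
      have e : (1 / τ) • (x i - x (i + 1)) - ContinuousLinearMap.adjoint V (y i)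
          - -(ContinuousLinearMap.adjoint V yh)
          = (1 / τ) • ((x i - xh) - (x (i + 1) - xh))
            - ContinuousLinearMap.adjoint V (y i - yh) := by
        rw [map_sub]; module
      rw [e, inner_sub_left, real_inner_smul_left, inner_sub_left, real_inner_self_eq_norm_sq,
        ContinuousLinearMap.adjoint_inner_left, real_inner_comm (V _) (y i - yh)] at h
      rw [hinv, smul_apply, real_inner_smul_left]
      have h' := mul_le_mul_of_nonneg_left h hτpos.le
      have e2 : ∀ r : ℝ, τ * (1 / τ * r) = r := by intro r; field_simp
      rw [mul_sub, e2] at h'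
      first
        | linarith
        | (rw [real_inner_comm] at h'; linarith)
    · have h := strong_mono hFstar (hy i) hyh
      have e : (1 / σ) • (y i - y (i + 1)) + A (x (i + 1) + ω • (x (i + 1) - x i)) - A xh
          = (1 / σ) • ((y i - yh) - (y (i + 1) - yh))
            + ((1 + ω) • V (x (i + 1) - xh) - ω • V (x i - xh)
              + (A - V) ((1 + ω) • (x (i + 1) - xh) - ω • (x i - xh))) := by
        simp only [map_sub, map_smul, map_add, sub_apply]; module
      rw [e, inner_add_left, real_inner_smul_left, inner_sub_left, real_inner_self_eq_norm_sq,
        inner_add_left, inner_sub_left ((1 + ω) • _), real_inner_smul_left, real_inner_smul_left] at h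
      rw [hinv]
      simp only [smul_apply, real_inner_smul_left]
      have h' := mul_le_mul_of_nonneg_left h hτpos.le
      have e2 : ∀ r : ℝ, τ * (1 / σ * r) = β * r := by
        intro r; rw [hσ, hβ]; field_simp
      have e3 : τ * (γF * ‖y (i + 1) - yh‖ ^ 2) = β * (τ * γG * ‖y (i + 1) - yh‖ ^ 2) := by
        rw [hβ]; field_simp
      rw [mul_add, e2, e3] at h'
      linarith
  obtain ⟨E, hE⟩ : ∃ E : ℕ → ℝ, E = fun i => (1 + ω) / 2 * ‖x i - xh‖ ^ 2
      + 2 / (1 + ω) * β * ‖y i - yh‖ ^ 2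
        - 2 * (2 * ω / (1 + ω)) * ⟪(τ • V) (x i - xh), y i - yh⟫ := ⟨_, rfl⟩
  have hdec : ∀ N, E N ≤ E 0 * ω ^ N := by
    intro N
    induction N with
    | zero => simp
    | succ k ih =>
      have h1 : E (k + 1) ≤ ω * E k := by rw [hE]; exact step k
      calc E (k + 1) ≤ ω * E k := h1
        _ ≤ ω * (E 0 * ω ^ k) := by gcongr
        _ = E 0 * ω ^ (k + 1) := by ring
  obtain ⟨ε, hε⟩ : ∃ ε, ε = min ((1 + ω) / 2) (2 / (1 + ω) * β) := ⟨_, rfl⟩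
  have hε0 : 0 < ε := by rw [hε]; exact lt_min (by positivity) (by positivity)
  have hc : 0 < 1 - 2 * ω / (1 + ω) := by
    have : 2 * ω / (1 + ω) < 1 := by rw [div_lt_one (by positivity)]; linarith
    linarith
  have hlow : ∀ N, (1 - 2 * ω / (1 + ω)) * ε * (‖x N - xh‖ ^ 2 + ‖y N - yh‖ ^ 2) ≤ E N := by
    intro N
    have t := young (β * (2 / (1 + ω))) ((1 + ω) / 2 * ‖x N - xh‖ ^ 2) (by positivity)
      ((τ • V) (x N - xh)) (y N - yh) (by
        refine (hVb _).trans (le_of_eq ?_)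
        field_simp)
    have hc0 : 0 ≤ 2 * ω / (1 + ω) := by positivity
    have t' := mul_nonneg hc0 t
    have b1 : ε * ‖x N - xh‖ ^ 2 ≤ (1 + ω) / 2 * ‖x N - xh‖ ^ 2 := by
      gcongr; rw [hε]; exact min_le_left _ _
    have b2 : ε * ‖y N - yh‖ ^ 2 ≤ 2 / (1 + ω) * β * ‖y N - yh‖ ^ 2 := by
      gcongr; rw [hε]; exact min_le_right _ _
    have b3 := mul_le_mul_of_nonneg_left (add_le_add b1 b2) hc.le
    rw [hE]
    dsimp only
    nlinarith
  have hk : 0 < (1 - 2 * ω / (1 + ω)) * ε := by positivity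
  refine ⟨E 0 / ((1 - 2 * ω / (1 + ω)) * ε), ?_, ?_⟩
  · refine div_nonneg (le_trans ?_ (hlow 0)) hk.le
    positivity
  · intro N
    rw [div_mul_eq_mul_div, le_div_iff₀ hk]
    calc _ = (1 - 2 * ω / (1 + ω)) * ε * (‖x N - xh‖ ^ 2 + ‖y N - yh‖ ^ 2) := by ring
      _ ≤ E N := hlow N
      _ ≤ _ := hdec N
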